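/- For every radial f ∈ L¹(ℍⁿ), every k ∈ ℕ, every λ ≠ 0 and every z ∈ ℂⁿ, with a = (λ,(2k+n)|λ|), the Strichartz Fourier transform is proportional to the Laguerre function: f̂(a,z) = R_k(−λ, f) · φ_{k,λ}(z). -/

import Mathlib

open MeasureTheory Complex Real Filter

noncomputable section

/-- ℂⁿ with its Euclidean (Hilbert space) structure. -/
abbrev Cn (n : ℕ) := EuclideanSpace ℂ (Fin n)

instance (n : ℕ) : MeasurableSpace (Cn n) := borel _
instance (n : ℕ) : BorelSpace (Cn n) := ⟨rfl⟩
instance (n : ℕ) : InnerProductSpace ℝ (Cn n) := InnerProductSpace.rclikeToReal ℂ (Cn n)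

/-- The Heisenberg group ℍⁿ = ℂⁿ × ℝ (as a measure space with Lebesgue/Haar measure). -/
abbrev Hn (n : ℕ) := Cn n × ℝ

/-- Im (z · w̄) = Im (∑ⱼ zⱼ conj wⱼ). -/
def imZW {n : ℕ} (z w : Cn n) : ℝ := (∑ j, z j * (starRingEnd ℂ) (w j)).im

/-- The λ-twisted convolution F ∗_λ G (z) = ∫ F(z−w) G(w) e^{(i/2)λ Im(z·w̄)} dw. -/
def twConv (n : ℕ) (lam : ℝ) (F G : Cn n → ℂ) (z : Cn n) : ℂ :=
  ∫ w : Cn n, F (z - w) * G w * Complex.exp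
    (Complex.I / 2 * (lam : ℂ) * ((imZW z w : ℝ) : ℂ))

/-- The inverse Fourier transform in the central variable, f^λ(z) = ∫ e^{iλt} f(z,t) dt. -/
def fLam (n : ℕ) (f : Hn n → ℂ) (lam : ℝ) (z : Cn n) : ℂ :=
  ∫ t : ℝ, Complex.exp (Complex.I * (lam : ℂ) * (t : ℂ)) * f (z, t)

/-- The Laguerre polynomial of type m−1:
L_k^{m−1}(t) = ∑_{j=0}^k binom(k+m−1, k−j) (−t)^j / j!. -/
def lagPoly (m k : ℕ) (t : ℝ) : ℝ :=
  ∑ j ∈ Finset.range (k + 1), ((k + m - 1).choose (k - j) : ℝ) * (-t) ^ j / (Nat.factorial j)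

/-- The Laguerre function φ_{k,λ}^{m−1}(z) = L_k^{m−1}(|λ||z|²/2) e^{−|λ||z|²/4} on ℂ^m. -/
def lagFun (m k : ℕ) (lam : ℝ) (z : Cn m) : ℝ :=
  lagPoly m k (|lam| * ‖z‖ ^ 2 / 2) * Real.exp (-(|lam| * ‖z‖ ^ 2 / 4))

/-- The Strichartz Fourier transform f̂(a,z) = f^{−λ} ∗_{−λ} φ_{k,λ}(z)
at the point a = (λ, (2k+n)|λ|) of the ray R_k. -/
def stri (n : ℕ) (f : Hn n → ℂ) (k : ℕ) (lam : ℝ) (z : Cn n) : ℂ :=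
  twConv n (-lam) (fLam n f (-lam)) (fun w => ((lagFun n k lam w : ℝ) : ℂ)) z

/-- The normalizing constant k!(n−1)!/(k+n−1)!. -/
def normC (n k : ℕ) : ℝ :=
  (Nat.factorial k * Nat.factorial (n - 1) : ℝ) / (Nat.factorial (k + n - 1))

/-- The Bessel kernel J_{n−1}(s)/s^{n−1}, extended by its limiting value
1/(2^{n−1}(n−1)!) at s = 0, given by its power series. -/
def besselKer (n : ℕ) (s : ℝ) : ℝ :=
  ∑' m : ℕ, (-1 : ℝ) ^ m / (Nat.factorial m * Nat.factorial (m + n - 1)) *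
    s ^ (2 * m) / 2 ^ (2 * m + n - 1)

/-- The Strichartz Fourier transform f̂((0,τ),z) on the limiting ray R_∞. -/
def striLim (n : ℕ) (f : Hn n → ℂ) (z : Cn n) (τ : ℝ) : ℂ :=
  ((Nat.factorial (n - 1) * 2 ^ (n - 1) : ℝ) : ℂ) *
    ∫ w : Cn n, fLam n f 0 (z - w) * ((besselKer n (Real.sqrt τ * ‖w‖) : ℝ) : ℂ)

/-- The Heisenberg fan Ω ⊆ ℝ²: union of the rays R_k, k ∈ ℕ, and the limiting ray R_∞. -/
def fan (n : ℕ) : Set (ℝ × ℝ) :=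
  {a | (∃ k : ℕ, a.1 ≠ 0 ∧ a.2 = (2 * k + n) * |a.1|) ∨ (a.1 = 0 ∧ 0 ≤ a.2)}

open scoped Classical in
/-- The index k of the ray R_k through a point of the fan (junk value otherwise). -/
def fanK (n : ℕ) (a : ℝ × ℝ) : ℕ :=
  if h : ∃ k : ℕ, a.2 = (2 * k + n) * |a.1| then h.choose else 0

/-- The normalized Strichartz Fourier transform f̃(a,z), as a function of a ∈ Ω. -/
def striNorm (n : ℕ) (f : Hn n → ℂ) (z : Cn n) (a : ℝ × ℝ) : ℂ :=
  if a.1 = 0 then striLim n f z a.2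
  else ((normC n (fanK n a) : ℝ) : ℂ) * stri n f (fanK n a) a.1 z

/-- The Plancherel measure ν on the Heisenberg fan:
∫ φ dν = (2π)^{−2n−1} ∫_ℝ (∑_k φ(λ,(2k+n)|λ|)) |λ|^{2n} dλ. -/
def fanMeasure (n : ℕ) : Measure (ℝ × ℝ) :=
  (ENNReal.ofReal ((2 * π) ^ (2 * n + 1)))⁻¹ •
    Measure.sum (fun k : ℕ =>
      Measure.map (fun lam : ℝ => (lam, (2 * k + n) * |lam|))
        (volume.withDensity fun lam => ENNReal.ofReal (|lam| ^ (2 * n))))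

/-- A function on ℍⁿ is radial if it is invariant under the action of the unitary group U(n). -/
def IsRadial (n : ℕ) (g : Hn n → ℂ) : Prop :=
  ∀ (U : Cn n ≃ₗᵢ[ℂ] Cn n) (x : Hn n), g (U x.1, x.2) = g x

/-- The k-th Laguerre coefficient R_k(λ, f) = (k!(n−1)!/(k+n−1)!) ∫ f^λ(w) φ_{k,λ}(w) dw. -/
def lagCoef (n : ℕ) (k : ℕ) (lam : ℝ) (f : Hn n → ℂ) : ℂ :=
  ((normC n k : ℝ) : ℂ) * ∫ w : Cn n, fLam n f lam w * ((lagFun n k lam w : ℝ) : ℂ)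

/-- The Gelfand (spherical Fourier) transform of a radial function on ℍ^m, evaluated at
(λ, (2j+m)|λ|). -/
def gelfand (m : ℕ) (h : Hn m → ℂ) (lam : ℝ) (j : ℕ) : ℂ :=
  ((normC m j : ℝ) : ℂ) *
    ∫ x : Hn m, h x * Complex.exp (Complex.I * (lam : ℂ) * (x.2 : ℂ)) *
      ((lagFun m j lam x.1 : ℝ) : ℂ)

/-- The group convolution on ℍⁿ: f∗g(x) = ∫ f(x·y⁻¹) g(y) dy. -/
def hConv (n : ℕ) (f g : Hn n → ℂ) (x : Hn n) : ℂ :=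
  ∫ y : Hn n, f (x.1 - y.1, x.2 - y.2 - imZW x.1 y.1 / 2) * g y

/-- P is a bigraded solid harmonic of degree (p,q) on ℂⁿ: P(z) = ∑_{|α|=p,|β|=q} c_{αβ} z^α z̄^β,
harmonic as a function on ℝ^{2n} (the harmonicity Δ P = 0 is expressed by the equivalent
algebraic condition on the coefficients). -/
def IsBigradedSolidHarmonic (n p q : ℕ) (P : Cn n → ℂ) : Prop :=
  ∃ c : (Fin n → ℕ) → (Fin n → ℕ) → ℂ,
    (∀ z : Cn n, P z =
      ∑ α ∈ Finset.Nat.antidiagonalTuple n p, ∑ β ∈ Finset.Nat.antidiagonalTuple n q,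
        c α β * (∏ j, z j ^ α j) * ∏ j, (starRingEnd ℂ) (z j) ^ β j) ∧
    (∀ γ δ : Fin n → ℕ,
      ∑ j : Fin n, (((γ j + 1) * (δ j + 1) : ℕ) : ℂ) *
        c (Function.update γ j (γ j + 1)) (Function.update δ j (δ j + 1)) = 0)

/-- The physicists' Hermite polynomial H_m(x) = (−1)^m e^{x²} (d/dx)^m e^{−x²}. -/
def physHermite (m : ℕ) (x : ℝ) : ℝ :=
  (-1 : ℝ) ^ m * Real.exp (x ^ 2) * iteratedDeriv m (fun y => Real.exp (-(y ^ 2))) x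

/-- The normalized Hermite function h_m(x) = (2^m m! √π)^{−1/2} H_m(x) e^{−x²/2}. -/
def hermiteFun (m : ℕ) (x : ℝ) : ℝ :=
  (Real.sqrt (2 ^ m * (Nat.factorial m) * Real.sqrt π))⁻¹ * physHermite m x *
    Real.exp (-(x ^ 2) / 2)

/-- The scaled Hermite function Φ_α^λ(x) = |λ|^{n/4} ∏ⱼ h_{αⱼ}(√|λ| xⱼ). -/
def scaledHermite (n : ℕ) (lam : ℝ) (α : Fin n → ℕ) (x : Fin n → ℝ) : ℝ :=
  |lam| ^ ((n : ℝ) / 4) * ∏ j, hermiteFun (α j) (Real.sqrt |lam| * x j)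

/-- The Schrödinger representation: π_λ(z,t)φ(ξ) = e^{iλt} e^{iλ(x·ξ+(1/2)x·y)} φ(ξ+y),
z = x+iy. -/
def schrodinger (n : ℕ) (lam : ℝ) (zt : Hn n) (φ : (Fin n → ℝ) → ℂ) (ξ : Fin n → ℝ) : ℂ :=
  Complex.exp (Complex.I * (lam : ℂ) * (zt.2 : ℂ)) *
    Complex.exp (Complex.I * (lam : ℂ) *
      (((∑ j, (zt.1 j).re * ξ j) + (∑ j, (zt.1 j).re * (zt.1 j).im) / 2 : ℝ) : ℂ)) *
    φ (fun j => ξ j + (zt.1 j).im)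

/-- The group Fourier transform f̂(λ)φ = ∫ f(z,t) π_λ(z,t)φ dz dt. -/
def groupFT (n : ℕ) (f : Hn n → ℂ) (lam : ℝ) (φ : (Fin n → ℝ) → ℂ) (ξ : Fin n → ℝ) : ℂ :=
  ∫ x : Hn n, f x * schrodinger n lam x φ ξ

/-- Vandermonde's identity, summed along a diagonal. -/
theorem sum_choose_mul_choose_add (q K M : ℕ) :
    ∑ p ∈ Finset.range (q + 1), q.choose p * K.choose (M + p) = (K + q).choose (M + q) := by
  induction q generalizing M with
  | zero => simp
  | succ q ih =>
    have h1 := ih M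
    have h2 := ih (M + 1)
    rw [Finset.sum_range_succ'] 
    simp only [Nat.choose_succ_succ q, add_mul, Finset.sum_add_distrib]
    rw [← add_assoc K, show M + (q + 1) = (M + q) + 1 by ring, Nat.choose_succ_succ (K + q)]
    rw [← h1, show (M + q).succ = M + 1 + q by omega, ← h2]
    have e1 : ∑ x ∈ Finset.range (q + 1), q.choose (x + 1) * K.choose (M + (x + 1)) +
        (q + 1).choose 0 * K.choose (M + 0) =
        ∑ p ∈ Finset.range (q + 1), q.choose p * K.choose (M + p) := by
      rw [Finset.sum_range_succ, Finset.sum_range_succ' (fun p => q.choose p * K.choose (M + p))]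
      simp
    have e2 : ∑ x ∈ Finset.range (q + 1), q.choose x * K.choose (M + (x + 1)) =
        ∑ p ∈ Finset.range (q + 1), q.choose p * K.choose (M + 1 + p) := by
      refine Finset.sum_congr rfl fun x _ => ?_
      rw [show M + (x + 1) = M + 1 + x by ring]
    rw [← e1, ← e2]; ring

/-- Nanjundiah's identity. -/
theorem sum_choose_mul_choose_mul_choose (a b α k : ℕ) :
    ∑ i ∈ Finset.range (b + 1), a.choose i * (b + α).choose (b - i) *
      (k + α + i).choose (α + a + b) = (k + α).choose (α + a) * k.choose b := by
  have h1 : ∀ i ∈ Finset.range (b + 1), (k + α + i).choose (α + a + b) =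
      ∑ j ∈ Finset.range (b + 1), i.choose j * (k + α).choose (α + a + b - j) := by
    intro i hi
    rw [Finset.mem_range] at hi
    rw [add_comm (k + α) i, Nat.add_choose_eq, Finset.Nat.sum_antidiagonal_eq_sum_range_succ
      (fun p q => i.choose p * (k + α).choose q)]
    refine (Finset.sum_subset (Finset.range_mono (by omega)) fun j _ hj => ?_).symm
    rw [Finset.mem_range] at hj
    rw [Nat.choose_eq_zero_of_lt (by omega), zero_mul]
  have h2 : ∀ j ∈ Finset.range (b + 1), ∑ i ∈ Finset.range (b + 1),
      a.choose i * i.choose j * (b + α).choose (b - i) =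
      a.choose j * (a + b + α - j).choose (b - j) := by
    intro j hj
    rw [Finset.mem_range] at hj
    rcases lt_or_ge a j with haj | haj
    · rw [Nat.choose_eq_zero_of_lt haj, zero_mul]
      refine Finset.sum_eq_zero fun i _ => ?_
      rcases lt_or_ge a i with h | h
      · simp [Nat.choose_eq_zero_of_lt h]
      · simp [Nat.choose_eq_zero_of_lt (lt_of_le_of_lt h haj)]
    · rw [show a + b + α - j = (a - j) + (b + α) by omega, Nat.add_choose_eq,
        Finset.Nat.sum_antidiagonal_eq_sum_range_succ
        (fun p q => (a - j).choose p * (b + α).choose q), Finset.mul_sum]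
      rw [← Finset.sum_subset (s₁ := Finset.Ico j (b + 1)), Finset.sum_Ico_eq_sum_range]
      · rw [show b + 1 - j = (b - j).succ by omega]
        refine Finset.sum_congr rfl fun i _ => ?_
        rw [Nat.choose_mul (by omega), show j + i - j = i by omega,
          show b - (j + i) = b - j - i by omega]
        ring
      · intro i hi
        simp at hi ⊢
        omega
      · intro i hi hi'
        simp at hi hi'
        rw [Nat.choose_eq_zero_of_lt (n := i) (by omega)]
        simp
  calc _ = ∑ j ∈ Finset.range (b + 1), (k + α).choose (α + a + b - j) *
      ∑ i ∈ Finset.range (b + 1), a.choose i * i.choose j * (b + α).choose (b - i) := by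
        simp only [Finset.mul_sum]
        rw [Finset.sum_comm]
        refine Finset.sum_congr rfl fun i hi => ?_
        rw [h1 i hi, Finset.mul_sum]
        exact Finset.sum_congr rfl fun j _ => by ring
    _ = ∑ j ∈ Finset.range (b + 1), (k + α).choose (α + a) *
        (a.choose j * (k - a).choose (b - j)) := by
        refine Finset.sum_congr rfl fun j hj => ?_
        rw [h2 j hj]
        rw [Finset.mem_range] at hj
        have := @Nat.choose_mul (k + α) (α + a + b - j) (α + a) (by omega)
        rw [show k + α - (α + a) = k - a by omega, show α + a + b - j - (α + a) = b - j by omega,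
          Nat.choose_symm_of_eq_add (a := α + a) (b := b - j) (by omega)] at this
        rw [show a + b + α - j = α + a + b - j by omega, mul_left_comm, this]
        ring
    _ = _ := by
        rw [← Finset.mul_sum]
        rcases lt_or_ge k a with h | h
        · rw [Nat.choose_eq_zero_of_lt (by omega)]; simp
        · have := Nat.add_choose_eq a (k - a) b
          rw [Finset.Nat.sum_antidiagonal_eq_sum_range_succ
            (fun p q => a.choose p * (k - a).choose q), show a + (k - a) = k by omega] at this
          rw [this]

/-- A truncated exponential-type expansion at a sum of two variables, summed over a box. -/
theorem sum_mul_add_pow_div_factorial (k : ℕ) (g : ℕ → ℂ) (hg : ∀ j, k < j → g j = 0) (a b : ℂ) :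
    ∑ j ∈ Finset.range (k + 1), g j * ((a + b) ^ j / j.factorial) =
      ∑ p ∈ Finset.range (k + 1), a ^ p / p.factorial *
        ∑ q ∈ Finset.range (k + 1), g (p + q) * (b ^ q / q.factorial) := by
  have h1 : ∀ j, g j * ((a + b) ^ j / j.factorial) = ∑ x ∈ Finset.HasAntidiagonal.antidiagonal j,
      g (x.1 + x.2) * (a ^ x.1 / x.1.factorial * (b ^ x.2 / x.2.factorial)) := by
    intro j
    rw [(Commute.all a b).add_pow', Finset.sum_div, Finset.mul_sum]
    refine Finset.sum_congr rfl fun x hx => ?_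
    rw [Finset.HasAntidiagonal.mem_antidiagonal] at hx
    subst hx
    rw [nsmul_eq_mul, Nat.cast_add_choose]
    have := Nat.cast_ne_zero (R := ℂ).2 (x.1 + x.2).factorial_ne_zero
    field_simp
  simp only [h1, Finset.mul_sum]
  rw [← Finset.sum_product', Finset.sum_sigma']
  refine Finset.sum_bij_ne_zero (fun x _ _ => x.2) ?_ ?_ ?_ ?_
  · rintro ⟨j, p, q⟩ hx _
    simp at hx ⊢
    omega
  · rintro ⟨j, p, q⟩ hx _ ⟨j', p', q'⟩ hx' _ h
    simp at hx hx' h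
    obtain ⟨rfl, rfl⟩ := h
    obtain rfl : j = j' := by omega
    rfl
  · rintro ⟨p, q⟩ hx h0
    have hpq : p + q ≤ k := by
      by_contra h
      exact h0 (by simp [hg (p + q) (by omega)])
    refine ⟨⟨p + q, p, q⟩, ?_, ?_, rfl⟩
    · simp; omega
    · intro h
      apply h0
      simp only at h ⊢
      rw [← h]; ring
  · rintro ⟨j, p, q⟩ _ _
    simp only
    ring

theorem lagPoly_eq_sum_choose (α k : ℕ) (t : ℝ) :
    (lagPoly (α + 1) k t : ℂ) = ∑ j ∈ Finset.range (k + 1),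
      ((k + α).choose (α + j) : ℂ) * ((-(t : ℂ)) ^ j / j.factorial) := by
  rw [lagPoly]
  push_cast
  refine Finset.sum_congr rfl fun j hj => ?_
  rw [Finset.mem_range] at hj
  rw [Nat.choose_symm_of_eq_add (n := k + (α + 1) - 1) (a := k - j) (b := α + j) (by omega),
    mul_div_assoc]
  rfl

theorem sum_range_add_eq_sum_range {q k : ℕ} (H : ℕ → ℂ) (h1 : ∀ a < q, H a = 0)
    (h2 : ∀ a, k < a → H a = 0) :
    ∑ c ∈ Finset.range (k + 1), H (q + c) = ∑ a ∈ Finset.range (k + 1), H a := by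
  have e := Finset.sum_Ico_eq_sum_range H q (q + (k + 1))
  rw [Nat.add_sub_cancel_left] at e
  rw [← e, Finset.range_eq_Ico]
  refine (Finset.sum_subset (s₂ := Finset.Ico 0 (q + (k + 1)))
    (Finset.Ico_subset_Ico_left (Nat.zero_le q)) fun a ha ha' => ?_).trans
    (Finset.sum_subset (Finset.Ico_subset_Ico_right (Nat.le_add_left (k + 1) q))
      fun a _ ha' => ?_).symm
  · simp at ha ha'
    exact h1 a (by omega)
  · simp at ha'
    exact h2 a (by omega)

theorem sum_choose_mul_choose_div (a b α k : ℕ) (hb : b ≤ k) :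
    ∑ q ∈ Finset.range (k + 1), (a.choose q : ℂ) * b.choose q *
        (k + α + q).choose (α + a + b) / (α + q).choose q =
      (k + α).choose (α + a) * (k + α).choose (α + b) / (k + α).choose α := by
  have hne : ∀ {n m : ℕ}, m ≤ n → (n.choose m : ℂ) ≠ 0 := fun h =>
    Nat.cast_ne_zero.2 (Nat.choose_pos h).ne'
  have h1 : ∀ q ∈ Finset.range (b + 1), (a.choose q : ℂ) * b.choose q *
        (k + α + q).choose (α + a + b) / (α + q).choose q =
      ((a.choose q * (b + α).choose (b - q) * (k + α + q).choose (α + a + b) : ℕ) : ℂ) /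
        (b + α).choose b := by
    intro q hq
    rw [Finset.mem_range] at hq
    have e := @Nat.choose_mul (b + α) (α + q) α (by omega)
    rw [Nat.add_sub_cancel, Nat.add_sub_cancel_left,
      Nat.choose_symm_of_eq_add (n := b + α) (a := α + q) (b := b - q) (by omega),
      Nat.choose_symm_of_eq_add (n := b + α) (a := α) (b := b) (by omega),
      Nat.choose_symm_of_eq_add (n := α + q) (a := α) (b := q) (by omega)] at e
    have e' : ((b + α).choose (b - q) : ℂ) * (α + q).choose q = (b + α).choose b * b.choose q := by
      exact_mod_cast e
    rw [div_eq_div_iff (hne (by omega)) (hne (by omega))]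
    push_cast
    linear_combination (-(a.choose q : ℂ) * (k + α + q).choose (α + a + b)) * e'
  rw [← Finset.sum_subset (s₁ := Finset.range (b + 1)) (Finset.range_mono (by omega)),
    Finset.sum_congr rfl h1, ← Finset.sum_div, ← Nat.cast_sum, sum_choose_mul_choose_mul_choose]
  · have e := @Nat.choose_mul (k + α) (α + b) α (by omega)
    rw [Nat.add_sub_cancel, Nat.add_sub_cancel_left,
      Nat.choose_symm_of_eq_add (n := α + b) (a := α) (b := b) (by omega), add_comm α b] at e
    have e' : ((k + α).choose (b + α) : ℂ) * (b + α).choose b = (k + α).choose α * k.choose b := by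
      exact_mod_cast e
    rw [div_eq_div_iff (hne (by omega)) (hne (by omega)), add_comm α b]
    push_cast
    linear_combination (-((k + α).choose (α + a) : ℂ)) * e'
  · intro q _ hq
    rw [Finset.mem_range] at hq
    rw [Nat.choose_eq_zero_of_lt (n := b) (by omega)]
    simp

/-- The product formula for Laguerre polynomials (Bailey), in the fully expanded form produced by
averaging the exponential-weighted Laguerre polynomial over the unitary group. -/
theorem lagPoly_mul_lagPoly (α k : ℕ) (x y : ℝ) :
    ∑ c ∈ Finset.range (k + 1), (-(x : ℂ)) ^ c / c.factorial *
      ∑ d ∈ Finset.range (k + 1), (-(y : ℂ)) ^ d / d.factorial *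
        ∑ p ∈ Finset.range (k + 1), ∑ q ∈ Finset.range (k + 1),
          ((k + α).choose (α + (c + (d + (p + q)))) : ℂ) / (p.factorial * q.factorial) *
            (if p ≤ q then (x * y : ℂ) ^ q / ((q - p).factorial * (α + q).choose q) else 0) =
      lagPoly (α + 1) k x * lagPoly (α + 1) k y / (k + α).choose α := by
  let T : ℕ → ℕ → ℕ → ℂ := fun q a b => (-(x : ℂ)) ^ a / a.factorial *
    ((-(y : ℂ)) ^ b / b.factorial) * ((a.choose q : ℂ) * b.choose q *
        (k + α + q).choose (α + a + b) / (α + q).choose q)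
  have hfac : ∀ q c : ℕ, ((q + c).choose q : ℂ) / (q + c).factorial =
      1 / (q.factorial * c.factorial) := by
    intro q c
    rw [Nat.cast_add_choose]
    have := Nat.cast_ne_zero (R := ℂ).2 (q + c).factorial_ne_zero
    have := Nat.cast_ne_zero (R := ℂ).2 q.factorial_ne_zero
    have := Nat.cast_ne_zero (R := ℂ).2 c.factorial_ne_zero
    field_simp
  have hp : ∀ c d q : ℕ, q ∈ Finset.range (k + 1) → ∑ p ∈ Finset.range (k + 1),
      ((k + α).choose (α + (c + (d + (p + q)))) : ℂ) / (p.factorial * q.factorial) *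
        (if p ≤ q then (x * y : ℂ) ^ q / ((q - p).factorial * (α + q).choose q) else 0) =
      (x * y : ℂ) ^ q / (q.factorial ^ 2 * (α + q).choose q) *
        (k + α + q).choose (α + (q + c) + (q + d)) := by
    intro c d q hq
    rw [Finset.mem_range] at hq
    rw [show α + (q + c) + (q + d) = (α + c + d + q) + q by ring, ← sum_choose_mul_choose_add,
      Nat.cast_sum, Finset.mul_sum,
      ← Finset.sum_subset (s₁ := Finset.range (q + 1)) (Finset.range_mono (by omega))]
    · refine Finset.sum_congr rfl fun p hp => ?_
      rw [Finset.mem_range] at hp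
      obtain ⟨r, rfl⟩ : ∃ r, q = p + r := ⟨q - p, by omega⟩
      have h := hfac p r
      have h0 := Nat.cast_ne_zero (R := ℂ).2 (p + r).factorial_ne_zero
      have := Nat.cast_ne_zero (R := ℂ).2 p.factorial_ne_zero
      have := Nat.cast_ne_zero (R := ℂ).2 r.factorial_ne_zero
      rw [div_eq_iff h0] at h
      rw [if_pos (by omega), Nat.add_sub_cancel_left, Nat.cast_mul, h,
        show α + (c + (d + (p + (p + r)))) = α + c + d + (p + r) + p by ring]
      field_simp
    · intro p _ hp
      rw [Finset.mem_range] at hp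
      rw [if_neg (by omega), mul_zero]
  have hT : ∀ q c d : ℕ, (-(x : ℂ)) ^ c / c.factorial * ((-(y : ℂ)) ^ d / d.factorial *
      ((x * y : ℂ) ^ q / (q.factorial ^ 2 * (α + q).choose q) *
        (k + α + q).choose (α + (q + c) + (q + d)))) = T q (q + c) (q + d) := by
    intro q c d
    have e : T q (q + c) (q + d) = (-(x : ℂ)) ^ (q + c) * (-(y : ℂ)) ^ (q + d) *
        (((q + c).choose q : ℂ) / (q + c).factorial) * (((q + d).choose q : ℂ) / (q + d).factorial) *
        (k + α + q).choose (α + (q + c) + (q + d)) / (α + q).choose q := by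
      simp only [T]; ring
    rw [e, hfac, hfac, pow_add, pow_add]
    have : (x * y : ℂ) ^ q = (-(x : ℂ)) ^ q * (-(y : ℂ)) ^ q := by rw [← mul_pow]; ring
    rw [this]
    ring
  have hTa : ∀ q a b, a < q → T q a b = 0 := by
    intro q a b h
    simp [T, Nat.choose_eq_zero_of_lt h]
  have hTb : ∀ q a b, b < q → T q a b = 0 := by
    intro q a b h
    simp [T, Nat.choose_eq_zero_of_lt h]
  have hTa' : ∀ q a b, k < a → T q a b = 0 := by
    intro q a b h
    rcases lt_or_ge b q with hb | hb
    · exact hTb q a b hb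
    · simp [T, Nat.choose_eq_zero_of_lt (show k + α + q < α + a + b by omega)]
  have hTb' : ∀ q a b, k < b → T q a b = 0 := by
    intro q a b h
    rcases lt_or_ge a q with hb | hb
    · exact hTa q a b hb
    · simp [T, Nat.choose_eq_zero_of_lt (show k + α + q < α + a + b by omega)]
  calc _ = ∑ c ∈ Finset.range (k + 1), ∑ d ∈ Finset.range (k + 1), ∑ q ∈ Finset.range (k + 1),
        T q (q + c) (q + d) := by
        refine Finset.sum_congr rfl fun c _ => ?_
        rw [Finset.mul_sum]
        refine Finset.sum_congr rfl fun d _ => ?_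
        rw [Finset.sum_comm, Finset.mul_sum, Finset.mul_sum]
        refine Finset.sum_congr rfl fun q hq => ?_
        rw [hp c d q hq, hT]
    _ = ∑ q ∈ Finset.range (k + 1), ∑ c ∈ Finset.range (k + 1), ∑ d ∈ Finset.range (k + 1),
        T q (q + c) (q + d) := by
        rw [Finset.sum_comm]
        simp_rw [fun d => Finset.sum_comm (s := Finset.range (k + 1)) (t := Finset.range (k + 1))
          (f := fun c q => T q (q + c) (q + d))]
        rw [Finset.sum_comm]
        exact Finset.sum_congr rfl fun q _ => Finset.sum_comm
    _ = ∑ q ∈ Finset.range (k + 1), ∑ a ∈ Finset.range (k + 1), ∑ b ∈ Finset.range (k + 1),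
        T q a b := by
        refine Finset.sum_congr rfl fun q _ => ?_
        rw [← sum_range_add_eq_sum_range (fun a => ∑ b ∈ Finset.range (k + 1), T q a b)
          (fun a ha => Finset.sum_eq_zero fun b _ => hTa q a b ha)
          (fun a ha => Finset.sum_eq_zero fun b _ => hTa' q a b ha)]
        exact Finset.sum_congr rfl fun c _ =>
          sum_range_add_eq_sum_range _ (hTb q _) (hTb' q _)
    _ = ∑ a ∈ Finset.range (k + 1), ∑ b ∈ Finset.range (k + 1), ∑ q ∈ Finset.range (k + 1),
        T q a b := by
        rw [Finset.sum_comm]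
        exact Finset.sum_congr rfl fun a _ => Finset.sum_comm
    _ = _ := by
        rw [lagPoly_eq_sum_choose, lagPoly_eq_sum_choose, Finset.sum_mul_sum, Finset.sum_div]
        refine Finset.sum_congr rfl fun a _ => ?_
        rw [Finset.sum_div]
        refine Finset.sum_congr rfl fun b hb => ?_
        rw [Finset.mem_range] at hb
        simp only [T]
        rw [← Finset.mul_sum, sum_choose_mul_choose_div a b α k (by omega)]
        ring

/-- A radial function on ℂⁿ that stays integrable against every exponential of the norm. -/
structure IsRapid {n : ℕ} (G : Cn n → ℂ) : Prop where
  radial : ∀ (U : Cn n ≃ₗᵢ[ℂ] Cn n) (w : Cn n), G (U w) = G w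
  integrable_exp : ∀ c : ℝ, Integrable fun w => (Real.exp (c * ‖w‖) : ℂ) * G w

theorem integral_comp_unitary {n : ℕ} (U : Cn n ≃ₗᵢ[ℂ] Cn n) (f : Cn n → ℂ) :
    ∫ w, f (U w) = ∫ w, f w := by
  let V : Cn n ≃ₗᵢ[ℝ] Cn n := { U.toLinearEquiv.restrictScalars ℝ with norm_map' := U.norm_map }
  exact V.measurePreserving.integral_comp' (f := V.toHomeomorph.toMeasurableEquiv) f

namespace IsRapid

variable {n : ℕ} {G : Cn n → ℂ}

theorem integrable_mul (hG : IsRapid G) {h : Cn n → ℂ} (hc : Continuous h) {C c : ℝ}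
    (hb : ∀ w, ‖h w‖ ≤ C * Real.exp (c * ‖w‖)) : Integrable fun w => h w * G w := by
  have h1 := (hG.integrable_exp c).bdd_mul (f := fun w => h w / (Real.exp (c * ‖w‖) : ℂ)) (c := C)
    (by
      refine Continuous.aestronglyMeasurable ?_
      refine hc.div (by fun_prop) fun w => ?_
      exact_mod_cast (Real.exp_pos _).ne')
    (Eventually.of_forall fun w => by
      rw [norm_div, Complex.norm_real, Real.norm_of_nonneg (Real.exp_pos _).le,
        div_le_iff₀ (Real.exp_pos _)]
      exact hb w)
  refine h1.congr (Eventually.of_forall fun w => ?_)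
  have : (Real.exp (c * ‖w‖) : ℂ) ≠ 0 := by exact_mod_cast (Real.exp_pos _).ne'
  simp only
  field_simp

theorem norm_pow_le (w : Cn n) (p : ℕ) : ‖w‖ ^ p ≤ p.factorial * Real.exp (1 * ‖w‖) := by
  have := Real.pow_div_factorial_le_exp ‖w‖ (norm_nonneg w) p
  rw [div_le_iff₀ (by positivity)] at this
  rw [one_mul]
  linarith

theorem norm_pow_mul (hG : IsRapid G) (p : ℕ) : IsRapid fun w => ((‖w‖ : ℝ) : ℂ) ^ p * G w where
  radial U w := by rw [U.norm_map, hG.radial]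
  integrable_exp c := by
    have := hG.integrable_mul (h := fun w => (Real.exp (c * ‖w‖) : ℂ) * ((‖w‖ : ℝ) : ℂ) ^ p)
      (C := p.factorial) (c := c + 1) (by fun_prop) fun w => by
        rw [norm_mul, norm_pow, Complex.norm_real, Complex.norm_real, norm_norm,
          Real.norm_of_nonneg (Real.exp_pos _).le, add_mul, Real.exp_add]
        have := mul_le_mul_of_nonneg_left (norm_pow_le w p) (Real.exp_pos (c * ‖w‖)).le
        linarith
    simpa only [mul_assoc] using this

theorem const_mul (hG : IsRapid G) (a : ℂ) : IsRapid fun w => a * G w where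
  radial U w := by rw [hG.radial]
  integrable_exp c := by
    refine ((hG.integrable_exp c).const_mul a).congr (Eventually.of_forall fun w => ?_)
    simp only
    ring

theorem integrable_mul_of_le_pow (hG : IsRapid G) {h : Cn n → ℂ} (hc : Continuous h) {C : ℝ}
    (hC : 0 ≤ C) (p : ℕ) (hb : ∀ w, ‖h w‖ ≤ C * ‖w‖ ^ p) : Integrable fun w => h w * G w :=
  hG.integrable_mul hc (C := C * p.factorial) (c := 1) fun w => by
    have := mul_le_mul_of_nonneg_left (norm_pow_le w p) hC
    have := hb w
    linarith

end IsRapid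

/-- The unitary group acts transitively on spheres. -/
theorem exists_unitary_apply_eq {n : ℕ} {u v : Cn n} (h : ‖u‖ = ‖v‖) :
    ∃ U : Cn n ≃ₗᵢ[ℂ] Cn n, U u = v := by
  rcases eq_or_ne u 0 with rfl | hu
  · refine ⟨LinearIsometryEquiv.refl ℂ _, ?_⟩
    rw [norm_zero] at h
    simp [norm_eq_zero.1 h.symm]
  have hu' : ‖u‖ ≠ 0 := norm_ne_zero_iff.2 hu
  have huc : ((‖u‖ : ℝ) : ℂ) ≠ 0 := by exact_mod_cast hu'
  have unit : ∀ x : Cn n, ‖x‖ = ‖u‖ → ‖((‖u‖ : ℝ) : ℂ)⁻¹ • x‖ = 1 := by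
    intro x hx
    rw [norm_smul, norm_inv, Complex.norm_real, norm_norm, hx, inv_mul_cancel₀ hu']
  let eu := LinearIsometryEquiv.toSpanUnitSingleton (𝕜 := ℂ) _ (unit u rfl)
  let ev := LinearIsometryEquiv.toSpanUnitSingleton (𝕜 := ℂ) _ (unit v h.symm)
  let L := (Submodule.subtypeₗᵢ _).comp (ev.toLinearIsometry.comp eu.symm.toLinearIsometry)
  refine ⟨L.extend.toLinearIsometryEquiv rfl, ?_⟩
  have h1 : L (eu ((‖u‖ : ℝ) : ℂ)) = v := by
    change ((ev (eu.symm (eu ((‖u‖ : ℝ) : ℂ)))) : Cn n) = v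
    rw [eu.symm_apply_apply]
    simp [ev, smul_smul, huc]
  have h2 : ((eu ((‖u‖ : ℝ) : ℂ)) : Cn n) = u := by
    simp [eu, smul_smul, huc]
  have h3 := L.extend_apply (eu ((‖u‖ : ℝ) : ℂ))
  rw [h1, h2] at h3
  simpa using h3

theorem integral_inner_eq_of_norm_eq {n : ℕ} {G : Cn n → ℂ} (hG : IsRapid G) (Φ : ℂ → ℂ)
    {u v : Cn n} (h : ‖u‖ = ‖v‖) :
    ∫ w, Φ (inner ℂ w u) * G w = ∫ w, Φ (inner ℂ w v) * G w := by
  obtain ⟨U, rfl⟩ := exists_unitary_apply_eq h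
  rw [← integral_comp_unitary U (fun w => Φ (inner ℂ w (U u)) * G w)]
  simp only [LinearIsometryEquiv.inner_map_map, hG.radial]

/-- Diagonal unitary maps. -/
def diagUnitary {n : ℕ} (d : Fin n → ℂ) (hd : ∀ i, ‖d i‖ = 1) : Cn n ≃ₗᵢ[ℂ] Cn n :=
  LinearIsometryEquiv.piLpCongrRight 2 fun i =>
    { LinearEquiv.smulOfNeZero ℂ ℂ (d i) (norm_ne_zero_iff.1 (by simp [hd i])) with
      norm_map' := fun x => by
        change ‖d i * x‖ = ‖x‖
        rw [norm_mul, hd i, one_mul] }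

theorem diagUnitary_apply {n : ℕ} (d : Fin n → ℂ) (hd : ∀ i, ‖d i‖ = 1) (w : Cn n) (i : Fin n) :
    diagUnitary d hd w i = d i * w i := by
  rfl

theorem exists_phase {p q : ℕ} (h : p ≠ q) :
    ∃ c : ℂ, ‖c‖ = 1 ∧ c ^ p * (starRingEnd ℂ) c ^ q = -1 := by
  have h0 : ((p : ℂ) - q) ≠ 0 := sub_ne_zero.2 (by exact_mod_cast h)
  refine ⟨Complex.exp ((π / (p - q) : ℝ) * Complex.I), Complex.norm_exp_ofReal_mul_I _, ?_⟩
  rw [← Complex.exp_conj, ← Complex.exp_nat_mul, ← Complex.exp_nat_mul, ← Complex.exp_add,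
    ← Complex.exp_pi_mul_I]
  congr 1
  simp only [map_mul, Complex.conj_ofReal, Complex.conj_I]
  push_cast
  field_simp
  ring

/-- Mixed monomials that are not balanced in one coordinate integrate to zero. -/
theorem integral_coord_eq_zero {n : ℕ} {G : Cn n → ℂ} (hG : IsRapid G) {i j : Fin n} (hij : i ≠ j)
    (a b : ℕ) {p q : ℕ} (hpq : p ≠ q) :
    ∫ w, (w i ^ a * (starRingEnd ℂ) (w i) ^ b * (w j ^ p * (starRingEnd ℂ) (w j) ^ q)) * G w = 0 := by
  obtain ⟨c, hc, hc'⟩ := exists_phase hpq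
  let U := diagUnitary (fun l => if l = j then c else 1) (fun l => by split_ifs <;> simp [hc])
  have h := integral_comp_unitary U (fun w : Cn n =>
    (w i ^ a * (starRingEnd ℂ) (w i) ^ b * (w j ^ p * (starRingEnd ℂ) (w j) ^ q)) * G w)
  have e : ∀ w, ((U w) i ^ a * (starRingEnd ℂ) ((U w) i) ^ b *
      ((U w) j ^ p * (starRingEnd ℂ) ((U w) j) ^ q)) * G (U w) =
      -((w i ^ a * (starRingEnd ℂ) (w i) ^ b * (w j ^ p * (starRingEnd ℂ) (w j) ^ q)) * G w) := by
    intro w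
    simp only [hG.radial, U, diagUnitary_apply, if_neg hij, if_true, map_mul, one_mul, mul_pow]
    linear_combination (w i ^ a * (starRingEnd ℂ) (w i) ^ b *
      (w j ^ p * (starRingEnd ℂ) (w j) ^ q)) * G w * hc'
  simp only [e, integral_neg] at h
  exact self_eq_neg.1 h.symm

theorem integral_inner_eq_zero {n : ℕ} {G : Cn n → ℂ} (hG : IsRapid G) (z : Cn n)
    {p q : ℕ} (hpq : p ≠ q) :
    ∫ w, (inner ℂ w z ^ p * (starRingEnd ℂ) (inner ℂ w z) ^ q) * G w = 0 := by
  obtain ⟨c, hc, hc'⟩ := exists_phase hpq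
  have h := integral_inner_eq_of_norm_eq hG (fun ζ => ζ ^ p * (starRingEnd ℂ) ζ ^ q)
    (u := c • z) (v := z) (by simp [norm_smul, hc])
  have e : ∀ w, inner ℂ w (c • z) ^ p * (starRingEnd ℂ) (inner ℂ w (c • z)) ^ q * G w =
      -(inner ℂ w z ^ p * (starRingEnd ℂ) (inner ℂ w z) ^ q * G w) := by
    intro w
    rw [inner_smul_right, map_mul, mul_pow, mul_pow]
    linear_combination (inner ℂ w z ^ p * (starRingEnd ℂ) (inner ℂ w z) ^ q) * G w * hc'
  simp only [e, integral_neg] at h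
  exact self_eq_neg.1 h.symm

/-- The `2(p + 1)`-th moment of one coordinate controls the mixed moment with another one. -/
theorem integral_coord_mixed {n : ℕ} {G : Cn n → ℂ} (hG : IsRapid G) {i j : Fin n} (hij : i ≠ j)
    (p : ℕ) :
    ((p + 1 : ℕ) : ℂ) * ∫ w, (w i ^ p * (starRingEnd ℂ) (w i) ^ p *
      (w j ^ 1 * (starRingEnd ℂ) (w j) ^ 1)) * G w =
    ∫ w, (w i ^ (p + 1) * (starRingEnd ℂ) (w i) ^ (p + 1)) * G w := by
  let N := p + 1
  let A : ℕ → ℕ → Cn n → ℂ := fun a b w => (w i ^ (N - a) * (starRingEnd ℂ) (w i) ^ (N - b) *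
      (w j ^ a * (starRingEnd ℂ) (w j) ^ b)) * G w
  have hcoord : ∀ (w : Cn n) (l : Fin n), ‖w l‖ ≤ ‖w‖ := fun w l => PiLp.norm_apply_le w l
  have hA : ∀ a b, Integrable (A a b) := by
    intro a b
    refine hG.integrable_mul_of_le_pow (C := 1) (by fun_prop) zero_le_one
      (N - a + (N - b) + (a + b)) fun w => ?_
    simp only [norm_mul, norm_pow, RCLike.norm_conj, one_mul, pow_add]
    gcongr <;> exact hcoord _ _
  let I : ℕ → ℂ := fun a => ∫ w, A a a w
  let T := ∫ w, (w i ^ N * (starRingEnd ℂ) (w i) ^ N) * G w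
  have key : ∀ m : ℕ, ∑ a ∈ Finset.range (N + 1), (N.choose a : ℂ) ^ 2 * I a * (m : ℂ) ^ a =
      T * ((m : ℂ) + 1) ^ N := by
    intro m
    let t : ℝ := √m
    have ht : (t : ℂ) * t = m := by
      have : t * t = m := Real.mul_self_sqrt (Nat.cast_nonneg m)
      exact_mod_cast this
    let u : Cn n := EuclideanSpace.single i 1 + (t : ℂ) • EuclideanSpace.single j 1
    let v : Cn n := ((‖u‖ : ℝ) : ℂ) • EuclideanSpace.single i 1
    have huv : ‖u‖ = ‖v‖ := by simp [v, norm_smul]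
    have hn : ((‖u‖ : ℝ) : ℂ) * ((‖u‖ : ℝ) : ℂ) = m + 1 := by
      have h := inner_self_eq_norm_sq_to_K (𝕜 := ℂ) u
      rw [← ht]
      rw [pow_two] at h
      refine h.symm.trans ?_
      simp only [u, inner_add_left, inner_add_right, inner_smul_left, inner_smul_right,
        EuclideanSpace.inner_single_left]
      simp [hij, hij.symm]
      ring
    have h := integral_inner_eq_of_norm_eq hG (fun ζ => ζ ^ N * (starRingEnd ℂ) ζ ^ N) huv
    have hv : ∀ w : Cn n, inner ℂ w v ^ N * (starRingEnd ℂ) (inner ℂ w v) ^ N * G w =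
        ((m : ℂ) + 1) ^ N * (w i ^ N * (starRingEnd ℂ) (w i) ^ N * G w) := by
      intro w
      rw [← hn]
      simp only [v, inner_smul_right, EuclideanSpace.inner_single_right, map_mul, mul_pow,
        Complex.conj_ofReal, Complex.conj_conj, map_one, one_pow]
      ring
    have hu : ∀ w : Cn n, inner ℂ w u ^ N * (starRingEnd ℂ) (inner ℂ w u) ^ N * G w =
        ∑ a ∈ Finset.range (N + 1), ∑ b ∈ Finset.range (N + 1),
          ((t : ℂ) ^ a * (t : ℂ) ^ b * (N.choose a * N.choose b)) * A b a w := by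
      intro w
      have e : inner ℂ w u = (starRingEnd ℂ) ((t : ℂ) * w j + w i) := by
        simp [u, EuclideanSpace.inner_single_right]
        ring
      rw [e, Complex.conj_conj, map_add, add_pow, add_pow, Finset.sum_mul_sum, Finset.sum_mul]
      refine Finset.sum_congr rfl fun a _ => ?_
      rw [Finset.sum_mul]
      refine Finset.sum_congr rfl fun b _ => ?_
      simp only [A, map_mul, Complex.conj_ofReal, mul_pow]
      ring
    simp only [hv, hu] at h
    rw [integral_const_mul, integral_finsetSum _ fun a _ => integrable_finsetSum _ fun b _ =>
      (hA b a).const_mul _] at h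
    rw [mul_comm T]
    refine Eq.trans (Finset.sum_congr rfl fun a ha => ?_) h
    rw [integral_finsetSum _ fun b _ => (hA b a).const_mul _]
    simp only [integral_const_mul]
    rw [Finset.sum_eq_single_of_mem a ha fun b _ hb => ?_]
    · rw [← mul_pow, ht]
      simp only [I]
      ring
    · rw [show ∫ w, A b a w = 0 from integral_coord_eq_zero hG hij _ _ hb, mul_zero]
  let P : Polynomial ℂ := ∑ a ∈ Finset.range (N + 1),
    Polynomial.C ((N.choose a : ℂ) ^ 2 * I a) * Polynomial.X ^ a
  let Q : Polynomial ℂ := Polynomial.C T * (Polynomial.X + 1) ^ N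
  have hPQ : P = Q := by
    refine Polynomial.eq_of_infinite_eval_eq _ _
      ((Set.infinite_range_of_injective (Nat.cast_injective (R := ℂ))).mono ?_)
    rintro _ ⟨m, rfl⟩
    simp only [Set.mem_ofPred_eq, P, Q, Polynomial.eval_finsetSum, Polynomial.eval_mul,
      Polynomial.eval_C, Polynomial.eval_pow, Polynomial.eval_X, Polynomial.eval_add,
      Polynomial.eval_one]
    exact key m
  have hc := congrArg (fun R => Polynomial.coeff R 1) hPQ
  simp only [P, Q, Polynomial.finsetSum_coeff, Polynomial.coeff_C_mul, Polynomial.coeff_X_pow,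
    Polynomial.coeff_X_add_one_pow] at hc
  rw [Finset.sum_eq_single_of_mem 1 (by simp [N])
    (fun b _ hb => by simp [Ne.symm hb])] at hc
  simp only [Nat.choose_one_right, if_true, mul_one] at hc
  have hN : (N : ℂ) ≠ 0 := by exact_mod_cast Nat.succ_ne_zero p
  have : (N : ℂ) * I 1 = T := by
    apply mul_left_cancel₀ hN
    linear_combination hc
  simpa only [I, A, N, Nat.add_sub_cancel] using this

theorem sum_coord_mul_conj {n : ℕ} (w : Cn n) :
    ∑ j, (w j ^ 1 * (starRingEnd ℂ) (w j) ^ 1) = ((‖w‖ : ℝ) : ℂ) ^ 2 := by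
  rw [← Complex.ofReal_pow, EuclideanSpace.norm_sq_eq]
  push_cast
  exact Finset.sum_congr rfl fun j _ => by rw [pow_one, pow_one, Complex.mul_conj']

theorem integral_coord_moment {α : ℕ} (i : Fin (α + 1)) (p : ℕ) {G : Cn (α + 1) → ℂ}
    (hG : IsRapid G) :
    ∫ w, (w i ^ p * (starRingEnd ℂ) (w i) ^ p) * G w =
      (∫ w, ((‖w‖ : ℝ) : ℂ) ^ (2 * p) * G w) / (α + p).choose p := by
  induction p generalizing G with
  | zero => simp
  | succ p ih =>
    let I : ℂ := ∫ w, (w i ^ (p + 1) * (starRingEnd ℂ) (w i) ^ (p + 1)) * G w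
    have h1 := ih (hG.norm_pow_mul 2)
    have hint : ∀ j, Integrable fun w : Cn (α + 1) => (w i ^ p * (starRingEnd ℂ) (w i) ^ p *
        (w j ^ 1 * (starRingEnd ℂ) (w j) ^ 1)) * G w := by
      intro j
      refine hG.integrable_mul_of_le_pow (C := 1) (by fun_prop) zero_le_one
        (p + p + (1 + 1)) fun w => ?_
      simp only [norm_mul, norm_pow, RCLike.norm_conj, one_mul, pow_add]
      gcongr <;> exact PiLp.norm_apply_le _ _
    have hN : ((p + 1 : ℕ) : ℂ) ≠ 0 := by exact_mod_cast Nat.succ_ne_zero p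
    have h2 : ∫ w, (w i ^ p * (starRingEnd ℂ) (w i) ^ p) * (((‖w‖ : ℝ) : ℂ) ^ 2 * G w) =
        I + α * (I / (p + 1 : ℕ)) := by
      have e : ∀ w : Cn (α + 1),
          (w i ^ p * (starRingEnd ℂ) (w i) ^ p) * (((‖w‖ : ℝ) : ℂ) ^ 2 * G w) =
          ∑ j, (w i ^ p * (starRingEnd ℂ) (w i) ^ p *
            (w j ^ 1 * (starRingEnd ℂ) (w j) ^ 1)) * G w := by
        intro w
        rw [← sum_coord_mul_conj, ← Finset.sum_mul, ← Finset.mul_sum, ← mul_assoc]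
      simp only [e]
      rw [integral_finsetSum _ fun j _ => hint j, ← Finset.add_sum_erase _ _ (Finset.mem_univ i)]
      congr 1
      · simp only [I]
        congr 1
        funext w
        ring
      · rw [Finset.sum_congr rfl (g := fun _ => I / (p + 1 : ℕ))]
        · simp
        · intro j hj
          rw [Finset.mem_erase] at hj
          rw [eq_div_iff hN, mul_comm]
          exact integral_coord_mixed hG hj.1.symm p
    have h3 : ∫ w : Cn (α + 1), ((‖w‖ : ℝ) : ℂ) ^ (2 * p) * (((‖w‖ : ℝ) : ℂ) ^ 2 * G w) =
        ∫ w, ((‖w‖ : ℝ) : ℂ) ^ (2 * (p + 1)) * G w := by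
      congr 1
      funext w
      ring
    rw [h2, h3] at h1
    have hne : ∀ {n m : ℕ}, m ≤ n → (n.choose m : ℂ) ≠ 0 := fun h =>
      Nat.cast_ne_zero.2 (Nat.choose_pos h).ne'
    rw [eq_div_iff (hne (by omega))] at h1 ⊢
    have hc : ((α + p + 1 : ℕ) : ℂ) * (α + p).choose p =
        (α + (p + 1)).choose (p + 1) * (p + 1 : ℕ) := by
      exact_mod_cast Nat.add_one_mul_choose_eq (α + p) p
    rw [← h1]
    change I * _ = _
    field_simp
    push_cast at hc ⊢
    linear_combination (-I) * hc

theorem integral_inner_moment {α : ℕ} {G : Cn (α + 1) → ℂ} (hG : IsRapid G) (z : Cn (α + 1))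
    (p q : ℕ) :
    ∫ w, (inner ℂ w z ^ p * (starRingEnd ℂ) (inner ℂ w z) ^ q) * G w =
      if p = q then ∫ w, (((‖z‖ : ℝ) : ℂ) * ((‖w‖ : ℝ) : ℂ)) ^ (2 * q) / (α + q).choose q * G w
      else 0 := by
  split_ifs with h
  · subst h
    have h1 := integral_inner_eq_of_norm_eq hG (fun ζ => ζ ^ p * (starRingEnd ℂ) ζ ^ p)
      (u := z) (v := ((‖z‖ : ℝ) : ℂ) • EuclideanSpace.single 0 1) (by simp [norm_smul])
    have h2 := integral_coord_moment 0 p hG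
    have e1 : ∀ w : Cn (α + 1),
        inner ℂ w (((‖z‖ : ℝ) : ℂ) • EuclideanSpace.single (0 : Fin (α + 1)) (1 : ℂ)) ^ p *
        (starRingEnd ℂ) (inner ℂ w (((‖z‖ : ℝ) : ℂ) •
          EuclideanSpace.single (0 : Fin (α + 1)) (1 : ℂ))) ^ p * G w =
        ((‖z‖ : ℝ) : ℂ) ^ (2 * p) * (w 0 ^ p * (starRingEnd ℂ) (w 0) ^ p * G w) := by
      intro w
      simp only [inner_smul_right, EuclideanSpace.inner_single_right, map_mul, mul_pow,
        Complex.conj_ofReal, Complex.conj_conj, one_mul]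
      ring
    have e2 : ∀ w : Cn (α + 1),
        (((‖z‖ : ℝ) : ℂ) * ((‖w‖ : ℝ) : ℂ)) ^ (2 * p) / (α + p).choose p * G w =
        ((‖z‖ : ℝ) : ℂ) ^ (2 * p) / (α + p).choose p * (((‖w‖ : ℝ) : ℂ) ^ (2 * p) * G w) := by
      intro w
      rw [mul_pow]
      ring
    simp only [e1, e2] at h1 ⊢
    rw [h1, integral_const_mul, integral_const_mul, h2]
    ring
  · exact integral_inner_eq_zero hG z h

theorem integral_pow_mul_exp {n : ℕ} {G : Cn n → ℂ} (hG : IsRapid G) {s : Cn n → ℂ}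
    (hs : Continuous s) {C : ℝ} (hC : 0 ≤ C) (hsC : ∀ w, ‖s w‖ ≤ C * ‖w‖) {m : ℕ → ℂ}
    (h : ∀ p q : ℕ, ∫ w, (s w ^ p * (starRingEnd ℂ) (s w) ^ q) * G w = if p = q then m q else 0)
    (p q : ℕ) :
    Integrable (fun w => (s w ^ p * (starRingEnd ℂ) (s w) ^ q * Complex.exp (s w)) * G w) ∧
    ∫ w, (s w ^ p * (starRingEnd ℂ) (s w) ^ q * Complex.exp (s w)) * G w =
      if p ≤ q then m q / (q - p).factorial else 0 := by
  have hexp : ∀ w, ‖s w‖ ^ (p + q) * Real.exp ‖s w‖ ≤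
      (C ^ (p + q) * (p + q).factorial) * Real.exp ((1 + C) * ‖w‖) := by
    intro w
    calc ‖s w‖ ^ (p + q) * Real.exp ‖s w‖ ≤ (C * ‖w‖) ^ (p + q) * Real.exp (C * ‖w‖) := by
          gcongr <;> exact hsC w
      _ = C ^ (p + q) * ‖w‖ ^ (p + q) * Real.exp (C * ‖w‖) := by rw [mul_pow]
      _ ≤ C ^ (p + q) * ((p + q).factorial * Real.exp (1 * ‖w‖)) * Real.exp (C * ‖w‖) := by
          gcongr
          exact IsRapid.norm_pow_le w (p + q)
      _ = _ := by rw [add_mul, Real.exp_add]; ring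
  have hGm : AEStronglyMeasurable G volume := by
    have := (hG.integrable_exp 0).aestronglyMeasurable
    simpa using this
  refine ⟨hG.integrable_mul (by fun_prop) fun w => le_trans ?_ (hexp w), ?_⟩
  · rw [norm_mul, norm_mul, norm_pow, norm_pow, RCLike.norm_conj, ← pow_add]
    gcongr
    exact Complex.norm_exp_le_exp_norm _
  have hsum := hasSum_integral_of_dominated_convergence (μ := (volume : Measure (Cn n)))
    (F := fun l w => (s w ^ (p + l) * (starRingEnd ℂ) (s w) ^ q) * G w / l.factorial)
    (f := fun w => (s w ^ p * (starRingEnd ℂ) (s w) ^ q * Complex.exp (s w)) * G w)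
    (fun l w => ‖s w‖ ^ (p + q) * ‖G w‖ * (‖s w‖ ^ l / l.factorial))
    (fun l => by
      have : Continuous fun w => s w ^ (p + l) * (starRingEnd ℂ) (s w) ^ q := by fun_prop
      exact (this.aestronglyMeasurable.mul hGm).mul_const (((l.factorial : ℕ) : ℂ)⁻¹))
    (fun l => Eventually.of_forall fun w => by
      simp only [norm_div, norm_mul, norm_pow, RCLike.norm_conj, Complex.norm_natCast]
      apply le_of_eq
      ring)
    (Eventually.of_forall fun w => (Real.summable_pow_div_factorial _).mul_left _)
    (by
      have : ∀ w, ∑' l : ℕ, ‖s w‖ ^ (p + q) * ‖G w‖ * (‖s w‖ ^ l / l.factorial) =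
          ‖(((‖s w‖ ^ (p + q) * Real.exp ‖s w‖ : ℝ) : ℂ)) * G w‖ := by
        intro w
        rw [tsum_mul_left, norm_mul, Complex.norm_real, Real.norm_of_nonneg (by positivity),
          Real.exp_eq_exp_ℝ, NormedSpace.exp_eq_tsum_div]
        ring
      simp only [this]
      refine (hG.integrable_mul (h := fun w => ((‖s w‖ ^ (p + q) * Real.exp ‖s w‖ : ℝ) : ℂ))
        (C := C ^ (p + q) * (p + q).factorial) (c := 1 + C) (by fun_prop) fun w => ?_).norm
      rw [Complex.norm_real, Real.norm_of_nonneg (by positivity)]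
      exact hexp w)
    (Eventually.of_forall fun w => by
      have h1 := (NormedSpace.expSeries_div_hasSum_exp (s w)).mul_left
        (s w ^ p * (starRingEnd ℂ) (s w) ^ q * G w)
      rw [← Complex.exp_eq_exp_ℂ] at h1
      rw [mul_right_comm _ (G w) (Complex.exp (s w))] at h1
      have h2 : ∀ l : ℕ, s w ^ p * (starRingEnd ℂ) (s w) ^ q * G w * (s w ^ l / l.factorial) =
          (s w ^ (p + l) * (starRingEnd ℂ) (s w) ^ q) * G w / l.factorial := fun l => by
        rw [pow_add]
        ring
      simp only [h2] at h1
      exact h1)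
  rw [← hsum.tsum_eq]
  simp only [integral_div, h]
  split_ifs with hpq
  · rw [tsum_eq_single (q - p) fun l hl => ?_, if_pos (by omega)]
    rw [if_neg (by omega), zero_div]
  · refine (tsum_congr fun l => ?_).trans tsum_zero
    rw [if_neg (by omega), zero_div]

theorem integral_sum_four {n : ℕ} (N : ℕ) (K : ℕ → ℕ → ℕ → ℕ → ℂ) (F : ℕ → ℕ → ℕ → Cn n → ℂ)
    (hF : ∀ d p q, Integrable (F d p q)) :
    ∫ w, ∑ c ∈ Finset.range N, ∑ d ∈ Finset.range N, ∑ p ∈ Finset.range N, ∑ q ∈ Finset.range N,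
      K c d p q * F d p q w =
    ∑ c ∈ Finset.range N, ∑ d ∈ Finset.range N, ∑ p ∈ Finset.range N, ∑ q ∈ Finset.range N,
      K c d p q * ∫ w, F d p q w := by
  have h0 : ∀ c d p q, Integrable fun w => K c d p q * F d p q w :=
    fun c d p q => (hF d p q).const_mul _
  have h1 : ∀ c d p, Integrable fun w => ∑ q ∈ Finset.range N, K c d p q * F d p q w :=
    fun c d p => integrable_finsetSum _ fun q _ => h0 c d p q
  have h2 : ∀ c d, Integrable fun w => ∑ p ∈ Finset.range N, ∑ q ∈ Finset.range N,
      K c d p q * F d p q w := fun c d => integrable_finsetSum _ fun p _ => h1 c d p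
  rw [integral_finsetSum _ fun c _ => integrable_finsetSum _ fun d _ => h2 c d]
  refine Finset.sum_congr rfl fun c _ => ?_
  rw [integral_finsetSum _ fun d _ => h2 c d]
  refine Finset.sum_congr rfl fun d _ => ?_
  rw [integral_finsetSum _ fun p _ => h1 c d p]
  refine Finset.sum_congr rfl fun p _ => ?_
  rw [integral_finsetSum _ fun q _ => h0 c d p q]
  exact Finset.sum_congr rfl fun q _ => integral_const_mul _ _

/-- The addition formula for Laguerre polynomials integrated against a radial function. -/
theorem integral_exp_mul_lagPoly {n : ℕ} (α k : ℕ) (x μ : ℝ) {G : Cn n → ℂ} (hG : IsRapid G)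
    {s : Cn n → ℂ} (hs : Continuous s) {C : ℝ} (hC : 0 ≤ C) (hsC : ∀ w, ‖s w‖ ≤ C * ‖w‖)
    (h : ∀ G' : Cn n → ℂ, IsRapid G' → ∀ p q : ℕ,
      ∫ w, (s w ^ p * (starRingEnd ℂ) (s w) ^ q) * G' w =
        if p = q then ∫ w, ((x : ℂ) * ((μ * ‖w‖ ^ 2 / 2 : ℝ) : ℂ)) ^ q / (α + q).choose q * G' w
        else 0) :
    ∫ w, Complex.exp (s w) *
        (lagPoly (α + 1) k (x + μ * ‖w‖ ^ 2 / 2 - 2 * (s w).re) : ℂ) * G w =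
      ∫ w, (lagPoly (α + 1) k x : ℂ) * (lagPoly (α + 1) k (μ * ‖w‖ ^ 2 / 2) : ℂ) /
        (k + α).choose α * G w := by
  let y : Cn n → ℝ := fun w => μ * ‖w‖ ^ 2 / 2
  let K : ℕ → ℕ → ℕ → ℕ → ℂ := fun c d p q =>
    (-(x : ℂ)) ^ c / c.factorial * ((-1) ^ d / d.factorial) *
      (((k + α).choose (α + (c + (d + (p + q)))) : ℂ) / (p.factorial * q.factorial))
  let H : ℕ → Cn n → ℂ := fun d w => (y w : ℂ) ^ d * G w
  have hH : ∀ d, IsRapid (H d) := by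
    intro d
    have := (hG.norm_pow_mul (2 * d)).const_mul (((μ / 2 : ℝ) : ℂ) ^ d)
    convert this using 1
    funext w
    simp only [H, y]
    rw [pow_mul, ← mul_assoc, ← mul_pow]
    push_cast
    ring
  let F₁ : ℕ → ℕ → ℕ → Cn n → ℂ := fun d p q w =>
    (s w ^ p * (starRingEnd ℂ) (s w) ^ q * Complex.exp (s w)) * H d w
  let F₂ : ℕ → ℕ → ℕ → Cn n → ℂ := fun d p q w =>
    (if p ≤ q then ((x : ℂ) * y w) ^ q / ((q - p).factorial * (α + q).choose q) else 0) * H d w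
  have hF₁ := fun d => integral_pow_mul_exp (hH d) hs hC hsC (h _ (hH d))
  have hF₂ : ∀ d p q, Integrable (F₂ d p q) := by
    intro d p q
    simp only [F₂]
    split_ifs
    · have := ((hH (d + q)).integrable_exp 0).const_mul
        ((x : ℂ) ^ q / ((q - p).factorial * (α + q).choose q))
      refine this.congr (Eventually.of_forall fun w => ?_)
      simp only [H, zero_mul, Real.exp_zero, Complex.ofReal_one, one_mul, mul_pow, pow_add]
      ring
    · simp
  have hF : ∀ d p q, ∫ w, F₁ d p q w = ∫ w, F₂ d p q w := by
    intro d p q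
    rw [show ∫ w, F₁ d p q w = _ from (hF₁ d p q).2]
    simp only [F₂]
    split_ifs
    · rw [← integral_div]
      congr 1
      funext w
      simp only [y]
      rw [mul_comm ((q - p).factorial : ℂ), ← div_div]
      ring
    · simp
  have hvan : ∀ j, k < j → ((k + α).choose (α + j) : ℂ) = 0 := fun j hj => by
    rw [Nat.choose_eq_zero_of_lt (by omega), Nat.cast_zero]
  have e₁ : ∀ w, Complex.exp (s w) *
        (lagPoly (α + 1) k (x + μ * ‖w‖ ^ 2 / 2 - 2 * (s w).re) : ℂ) * G w =
      ∑ c ∈ Finset.range (k + 1), ∑ d ∈ Finset.range (k + 1), ∑ p ∈ Finset.range (k + 1),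
        ∑ q ∈ Finset.range (k + 1), K c d p q * F₁ d p q w := by
    intro w
    have harg : -((x + μ * ‖w‖ ^ 2 / 2 - 2 * (s w).re : ℝ) : ℂ) =
        -(x : ℂ) + (-(y w : ℂ) + (s w + (starRingEnd ℂ) (s w))) := by
      rw [Complex.add_conj]
      simp only [y]
      push_cast
      ring
    rw [lagPoly_eq_sum_choose, harg, sum_mul_add_pow_div_factorial k _ hvan]
    rw [Finset.mul_sum, Finset.sum_mul]
    refine Finset.sum_congr rfl fun c _ => ?_
    rw [sum_mul_add_pow_div_factorial k (fun d => ((k + α).choose (α + (c + d)) : ℂ))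
      (fun j hj => hvan _ (by omega))]
    rw [Finset.mul_sum, Finset.mul_sum, Finset.sum_mul]
    refine Finset.sum_congr rfl fun d _ => ?_
    rw [sum_mul_add_pow_div_factorial k (fun p => ((k + α).choose (α + (c + (d + p))) : ℂ))
      (fun j hj => hvan _ (by omega))]
    simp only [Finset.mul_sum, Finset.sum_mul]
    refine Finset.sum_congr rfl fun p _ => Finset.sum_congr rfl fun q _ => ?_
    simp only [K, F₁, H]
    rw [neg_pow (y w : ℂ)]
    ring
  have e₂ : ∀ w, (lagPoly (α + 1) k x : ℂ) * (lagPoly (α + 1) k (μ * ‖w‖ ^ 2 / 2) : ℂ) /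
        (k + α).choose α * G w =
      ∑ c ∈ Finset.range (k + 1), ∑ d ∈ Finset.range (k + 1), ∑ p ∈ Finset.range (k + 1),
        ∑ q ∈ Finset.range (k + 1), K c d p q * F₂ d p q w := by
    intro w
    rw [← lagPoly_mul_lagPoly]
    simp only [Finset.mul_sum, Finset.sum_mul]
    refine Finset.sum_congr rfl fun c _ => Finset.sum_congr rfl fun d _ =>
      Finset.sum_congr rfl fun p _ => Finset.sum_congr rfl fun q _ => ?_
    simp only [K, F₂, H, y]
    rw [neg_pow ((μ * ‖w‖ ^ 2 / 2 : ℝ) : ℂ)]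
    ring
  simp only [e₁, e₂]
  rw [integral_sum_four _ K F₁ fun d p q => (hF₁ d p q).1, integral_sum_four _ K F₂ hF₂]
  simp only [hF]

theorem isRapid_mul_gaussian {n : ℕ} {F : Cn n → ℂ} (hF : Integrable F)
    (hrad : ∀ (U : Cn n ≃ₗᵢ[ℂ] Cn n) (w : Cn n), F (U w) = F w) {μ : ℝ} (hμ : 0 < μ) :
    IsRapid fun w => F w * (Real.exp (-(μ * ‖w‖ ^ 2 / 4)) : ℂ) where
  radial U w := by rw [hrad, U.norm_map]
  integrable_exp c := by
    have h := hF.bdd_mul (c := Real.exp (c ^ 2 / μ))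
      (f := fun w => ((Real.exp (c * ‖w‖) * Real.exp (-(μ * ‖w‖ ^ 2 / 4)) : ℝ) : ℂ))
      (Continuous.aestronglyMeasurable (by fun_prop)) (Eventually.of_forall fun w => by
        rw [Complex.norm_real, Real.norm_of_nonneg (by positivity), ← Real.exp_add]
        apply Real.exp_le_exp.2
        rw [le_div_iff₀ hμ]
        nlinarith [sq_nonneg (μ * ‖w‖ / 2 - c)])
    refine h.congr (Eventually.of_forall fun w => ?_)
    simp only
    push_cast
    ring

theorem integrable_fLam {n : ℕ} {f : Hn n → ℂ} (hf : Integrable f (volume : Measure (Hn n)))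
    (lam : ℝ) : Integrable (fLam n f lam) := by
  rw [Measure.volume_eq_prod] at hf
  have h := hf.bdd_mul (c := 1)
    (f := fun x : Hn n => Complex.exp (Complex.I * (lam : ℂ) * (x.2 : ℂ)))
    (Continuous.aestronglyMeasurable (by fun_prop)) (Eventually.of_forall fun x => by
      rw [Complex.norm_exp]
      simp)
  exact h.integral_prod_left

theorem imZW_eq_im_inner {n : ℕ} (z w : Cn n) : imZW z w = (inner ℂ w z : ℂ).im := by
  rw [imZW, PiLp.inner_apply]
  rfl

theorem normC_eq_inv_choose (α k : ℕ) : normC (α + 1) k = ((k + α).choose α : ℝ)⁻¹ := by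
  rw [normC, Nat.add_sub_cancel, ← add_assoc, Nat.add_sub_cancel, add_comm k α,
    Nat.cast_add_choose, inv_div]
  ring

/-- For radial f ∈ L¹(ℍⁿ), the Strichartz Fourier transform is proportional to the Laguerre
function: f̂(a,z) = R_k(−λ,f) φ_{k,λ}(z). -/
theorem strichartz_radial (n : ℕ) (hn : 1 ≤ n) (f : Hn n → ℂ)
    (hf : Integrable f (volume : Measure (Hn n))) (hrad : IsRadial n f)
    (k : ℕ) (lam : ℝ) (hlam : lam ≠ 0) (z : Cn n) :
    stri n f k lam z = lagCoef n k (-lam) f * ((lagFun n k lam z : ℝ) : ℂ) := by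
  obtain ⟨α, rfl⟩ : ∃ α, n = α + 1 := ⟨n - 1, by omega⟩
  have hμ : 0 < |lam| := abs_pos.2 hlam
  set μ := |lam| with hμdef
  let F := fLam (α + 1) f (-lam)
  have hF : Integrable F := integrable_fLam hf (-lam)
  have hFrad : ∀ (U : Cn (α + 1) ≃ₗᵢ[ℂ] Cn (α + 1)) w, F (U w) = F w := by
    intro U w
    simp only [F, fLam]
    congr 1
    funext t
    rw [hrad U (w, t)]
  have hG := isRapid_mul_gaussian hF hFrad hμ
  let x : ℝ := μ * ‖z‖ ^ 2 / 2
  let G : Cn (α + 1) → ℂ := fun w => F w * (Real.exp (-(μ * ‖w‖ ^ 2 / 4)) : ℂ)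
  have hinner : ∀ G' : Cn (α + 1) → ℂ, IsRapid G' → ∀ p q : ℕ,
      ∫ w, (((μ / 2 : ℂ) * inner ℂ w z) ^ p * (starRingEnd ℂ) ((μ / 2 : ℂ) * inner ℂ w z) ^ q) *
        G' w =
        if p = q then ∫ w, ((x : ℂ) * ((μ * ‖w‖ ^ 2 / 2 : ℝ) : ℂ)) ^ q / (α + q).choose q * G' w
        else 0 := by
    intro G' hG' p q
    have h := congrArg (fun I : ℂ => (μ / 2 : ℂ) ^ (p + q) * I) (integral_inner_moment hG' z p q)
    simp only [← integral_const_mul] at h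
    have hconj : (starRingEnd ℂ) (μ / 2 : ℂ) = (μ / 2 : ℂ) := by
      rw [show (μ / 2 : ℂ) = ((μ / 2 : ℝ) : ℂ) by push_cast; rfl, Complex.conj_ofReal]
    refine Eq.trans (congrArg _ (funext fun w => ?_)) (h.trans ?_)
    · rw [map_mul, hconj, mul_pow, mul_pow, pow_add]
      ring
    · split_ifs with hpq
      · subst hpq
        rw [← integral_const_mul]
        congr 1
        funext w
        rw [← mul_assoc, ← mul_div_assoc, ← two_mul, pow_mul, pow_mul, ← mul_pow]
        simp only [x]
        push_cast
        ring
      · rw [mul_zero]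
  obtain ⟨s, hs, hsC, hsre, hsexp, hsmom⟩ : ∃ s : Cn (α + 1) → ℂ, Continuous s ∧
      (∀ w, ‖s w‖ ≤ (μ / 2 * ‖z‖) * ‖w‖) ∧
      (∀ w, (s w).re = μ / 2 * (inner ℂ w z : ℂ).re) ∧
      (∀ w, (s w).im = lam / 2 * (inner ℂ w z : ℂ).im) ∧
      (∀ G' : Cn (α + 1) → ℂ, IsRapid G' → ∀ p q : ℕ,
      ∫ w, (s w ^ p * (starRingEnd ℂ) (s w) ^ q) * G' w =
        if p = q then ∫ w, ((x : ℂ) * ((μ * ‖w‖ ^ 2 / 2 : ℝ) : ℂ)) ^ q / (α + q).choose q * G' w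
        else 0) := by
    have hb : ∀ w : Cn (α + 1), ‖(μ / 2 : ℂ) * inner ℂ w z‖ ≤ (μ / 2 * ‖z‖) * ‖w‖ := by
      intro w
      rw [show (μ / 2 : ℂ) = ((μ / 2 : ℝ) : ℂ) by push_cast; rfl, norm_mul, Complex.norm_real,
        Real.norm_of_nonneg (by positivity), mul_assoc]
      have := norm_inner_le_norm (𝕜 := ℂ) w z
      rw [mul_comm] at this
      gcongr
    rcases lt_or_gt_of_ne hlam with hneg | hpos
    · refine ⟨fun w => (starRingEnd ℂ) ((μ / 2 : ℂ) * inner ℂ w z), by fun_prop, fun w => ?_,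
        fun w => ?_, fun w => ?_, fun G' hG' p q => ?_⟩
      · rw [RCLike.norm_conj]
        exact hb w
      · rw [Complex.conj_re, show (μ / 2 : ℂ) = ((μ / 2 : ℝ) : ℂ) by push_cast; rfl,
          Complex.re_ofReal_mul]
      · rw [Complex.conj_im, show (μ / 2 : ℂ) = ((μ / 2 : ℝ) : ℂ) by push_cast; rfl,
          Complex.im_ofReal_mul, hμdef, abs_of_neg hneg]
        ring
      · refine Eq.trans (congrArg _ (funext fun w => ?_)) ((hinner G' hG' q p).trans ?_)
        · rw [Complex.conj_conj]
          ring
        · by_cases h : p = q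
          · subst h; rfl
          · rw [if_neg h, if_neg (Ne.symm h)]
    · refine ⟨fun w => (μ / 2 : ℂ) * inner ℂ w z, by fun_prop, hb,
        fun w => ?_, fun w => ?_, hinner⟩
      · simp
      · rw [hμdef, abs_of_pos hpos]
        simp
  have key := integral_exp_mul_lagPoly α k x μ hG hs (by positivity) hsC hsmom
  have hnorm : ∀ w : Cn (α + 1), μ * ‖z - w‖ ^ 2 / 2 = x + μ * ‖w‖ ^ 2 / 2 - 2 * (s w).re := by
    intro w
    have h := @norm_sub_sq ℂ _ _ _ _ w z
    rw [norm_sub_rev, h, hsre]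
    simp only [x, RCLike.re_to_complex]
    ring
  have e₁ : stri (α + 1) f k lam z = (Real.exp (-(x / 2)) : ℂ) * ∫ w, Complex.exp (s w) *
      (lagPoly (α + 1) k (x + μ * ‖w‖ ^ 2 / 2 - 2 * (s w).re) : ℂ) * G w := by
    rw [stri, twConv, ← integral_sub_left_eq_self _ volume z, ← integral_const_mul]
    congr 1
    funext w
    have him : imZW z (z - w) = -(inner ℂ w z : ℂ).im := by
      rw [imZW_eq_im_inner, inner_sub_left, Complex.sub_im, inner_self_eq_norm_sq_to_K]
      simp [← Complex.ofReal_pow]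
    have hphase : (Real.exp (-(μ * ‖z - w‖ ^ 2 / 4)) : ℂ) *
        Complex.exp (Complex.I / 2 * ((-lam : ℝ) : ℂ) * ((imZW z (z - w) : ℝ) : ℂ)) =
        (Real.exp (-(x / 2)) : ℂ) * Complex.exp (s w) *
          (Real.exp (-(μ * ‖w‖ ^ 2 / 4)) : ℂ) := by
      rw [Complex.ofReal_exp, Complex.ofReal_exp, Complex.ofReal_exp, ← Complex.exp_add,
        ← Complex.exp_add, ← Complex.exp_add]
      congr 1
      rw [show μ * ‖z - w‖ ^ 2 / 4 = (μ * ‖z - w‖ ^ 2 / 2) / 2 by ring, hnorm, him]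
      conv_rhs => rw [← Complex.re_add_im (s w)]
      rw [hsexp]
      push_cast
      ring
    rw [sub_sub_cancel, lagFun, ← hμdef, hnorm]
    simp only [G]
    push_cast at hphase ⊢
    linear_combination (F w * (lagPoly (α + 1) k
      (x + μ * ‖w‖ ^ 2 / 2 - 2 * (s w).re) : ℂ)) * hphase
  have e₂ : ∫ w, (lagPoly (α + 1) k x : ℂ) * (lagPoly (α + 1) k (μ * ‖w‖ ^ 2 / 2) : ℂ) /
        (k + α).choose α * G w = (lagPoly (α + 1) k x : ℂ) * lagCoef (α + 1) k (-lam) f := by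
    rw [lagCoef, normC_eq_inv_choose, ← integral_const_mul, ← integral_const_mul]
    congr 1
    funext w
    simp only [G, F, lagFun, abs_neg, ← hμdef]
    push_cast
    ring
  rw [e₁, key, e₂, lagFun, ← hμdef,
    show μ * ‖z‖ ^ 2 / 4 = x / 2 by simp only [x]; ring]
  push_cast
  ring
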